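/- Let n ≥ 2 be an integer, x₀ ∈ ℝⁿ, ε₀ > 0, and let Q : ℝⁿ → [0,∞] be measurable with spherical mean q(r) := q_{x₀}(r) over S(x₀,r), where r ↦ q(r) is measurable and 0 < q(r) < ∞ for almost every r ∈ (0, ε₀). Set ψ(t) = 1/(t·q(t)^{1/(n−1)}) and I(ε, ε₀) = ∫_ε^{ε₀} ψ(t) dt. Assume that ∫_0^{ε₀} ψ(t) dt = +∞ while I(ε, ε₀) < ∞ for every ε ∈ (0, ε₀). Then ∫_{{x : ε < |x−x₀| < ε₀}} Q(x)·ψ(|x−x₀|)ⁿ dm(x) = o(I(ε, ε₀)ⁿ) as ε → 0⁺; that is, the ratio (∫_{{x : ε < |x−x₀| < ε₀}} Q(x)·ψ(|x−x₀|)ⁿ dm(x)) / I(ε, ε₀)ⁿ tends to 0 as ε → 0⁺. -/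

import Mathlib

open MeasureTheory Set Filter ENNReal Metric

/-- The surface measure on the unit sphere of `ℝⁿ` (total mass `ω_{n-1}`). -/
noncomputable def sphereMeasure (n : ℕ) :
    Measure (Metric.sphere (0 : EuclideanSpace ℝ (Fin n)) 1) :=
  (volume : Measure (EuclideanSpace ℝ (Fin n))).toSphere

/-- The area `ω_{n-1}` of the unit sphere in `ℝⁿ`. -/
noncomputable def sphereArea (n : ℕ) : ℝ≥0∞ := sphereMeasure n Set.univ

/-- The spherical mean `q_{x₀}(r)` of `Q` over the sphere `S(x₀, r)`. -/
noncomputable def sphericalMean (n : ℕ) (Q : EuclideanSpace ℝ (Fin n) → ℝ≥0∞)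
    (x₀ : EuclideanSpace ℝ (Fin n)) (r : ℝ) : ℝ≥0∞ :=
  (∫⁻ θ : Metric.sphere (0 : EuclideanSpace ℝ (Fin n)) 1,
      Q (x₀ + r • (θ : EuclideanSpace ℝ (Fin n))) ∂(sphereMeasure n)) / sphereArea n

open scoped Topology

/-- Polar coordinates for the Lebesgue integral. -/
theorem polar_lintegral (n : ℕ) (hn : 2 ≤ n) (f : EuclideanSpace ℝ (Fin n) → ℝ≥0∞)
    (hf : Measurable f) :
    ∫⁻ x, f x = ∫⁻ r in Set.Ioi (0:ℝ), ENNReal.ofReal (r ^ (n - 1)) *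
      ∫⁻ θ : Metric.sphere (0 : EuclideanSpace ℝ (Fin n)) 1,
        f (r • (θ : EuclideanSpace ℝ (Fin n))) ∂(sphereMeasure n) := by
  have : Nonempty (Fin n) := ⟨⟨0, by omega⟩⟩
  have : Nontrivial (EuclideanSpace ℝ (Fin n)) := inferInstance
  have hmp := (volume : Measure (EuclideanSpace ℝ (Fin n))).measurePreserving_homeomorphUnitSphereProd
  have hsm : Measurable (fun p : Metric.sphere (0 : EuclideanSpace ℝ (Fin n)) 1 × Set.Ioi (0:ℝ) =>
      f ((p.2 : ℝ) • (p.1 : EuclideanSpace ℝ (Fin n)))) := by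
    apply hf.comp
    exact (measurable_subtype_coe.comp measurable_snd).smul
      (measurable_subtype_coe.comp measurable_fst)
  have hsm' : Measurable (fun p : Set.Ioi (0:ℝ) × Metric.sphere (0 : EuclideanSpace ℝ (Fin n)) 1 =>
      f ((p.1 : ℝ) • (p.2 : EuclideanSpace ℝ (Fin n)))) := hsm.comp measurable_swap
  calc ∫⁻ x, f x = ∫⁻ x in ({0}ᶜ : Set (EuclideanSpace ℝ (Fin n))), f x := by
        rw [Measure.restrict_congr_set (ae_eq_univ.2 (by simp)), Measure.restrict_univ]
    _ = ∫⁻ x : ({0}ᶜ : Set (EuclideanSpace ℝ (Fin n))), f x ∂(volume.comap Subtype.val) :=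
        (lintegral_subtype_comap (measurableSet_singleton _).compl f).symm
    _ = ∫⁻ p, f ((p.2 : ℝ) • (p.1 : EuclideanSpace ℝ (Fin n)))
          ∂((sphereMeasure n).prod (Measure.volumeIoiPow (n - 1))) := by
        have h2 := hmp.lintegral_comp hsm
        rw [finrank_euclideanSpace_fin] at h2
        rw [sphereMeasure, ← h2]
        refine lintegral_congr fun x => ?_
        have hx : ‖(x : EuclideanSpace ℝ (Fin n))‖ ≠ 0 := by
          exact norm_ne_zero_iff.2 x.2
        simp [smul_smul, hx]
    _ = ∫⁻ r, ∫⁻ θ, f ((r : ℝ) • (θ : EuclideanSpace ℝ (Fin n))) ∂(sphereMeasure n)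
          ∂(Measure.volumeIoiPow (n - 1)) := by
        have : IsFiniteMeasure (sphereMeasure n) := by unfold sphereMeasure; infer_instance
        exact lintegral_prod_symm _ hsm.aemeasurable
    _ = _ := by
        have : IsFiniteMeasure (sphereMeasure n) := by unfold sphereMeasure; infer_instance
        rw [Measure.volumeIoiPow, lintegral_withDensity_eq_lintegral_mul _ (by fun_prop)
          hsm'.lintegral_prod_right']
        rw [← lintegral_subtype_comap measurableSet_Ioi]
        rfl

theorem stmt3_aux (n : ℕ) (hn : 2 ≤ n) (x₀ : EuclideanSpace ℝ (Fin n)) (ε₀ : ℝ)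
    (Q : EuclideanSpace ℝ (Fin n) → ℝ≥0∞) (hQ : Measurable Q)
    (q : ℝ → ℝ≥0∞) (hq : ∀ r : ℝ, q r = sphericalMean n Q x₀ r)
    (hqfin : ∀ᵐ r ∂(volume.restrict (Set.Ioo (0:ℝ) ε₀)), 0 < q r ∧ q r < ∞)
    (ψ : ℝ → ℝ≥0∞) (hψm : Measurable ψ)
    (hψ : ∀ t : ℝ, ψ t = (ENNReal.ofReal t * q t ^ (1 / ((n : ℝ) - 1)))⁻¹)
    (ε : ℝ) (hε : 0 < ε) :
      (∫⁻ x in {x : EuclideanSpace ℝ (Fin n) | ε < dist x x₀ ∧ dist x x₀ < ε₀},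
          Q x * ψ (dist x x₀) ^ n) = sphereArea n * (∫⁻ t in Set.Ioo ε ε₀, ψ t) := by
  have : Nonempty (Fin n) := ⟨⟨0, by omega⟩⟩
  have : Nontrivial (EuclideanSpace ℝ (Fin n)) := inferInstance
  have hfinm : IsFiniteMeasure (sphereMeasure n) := by unfold sphereMeasure; infer_instance
  have hω : sphereArea n ≠ ∞ := measure_ne_top _ _
  have hω0 : sphereArea n ≠ 0 := by
    rw [sphereArea, Ne, Measure.measure_univ_eq_zero, sphereMeasure]
    exact Measure.toSphere_ne_zero _
  set A := {x : EuclideanSpace ℝ (Fin n) | ε < dist x x₀ ∧ dist x x₀ < ε₀} with hA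
  have hAm : MeasurableSet A := by
    have hdm : Measurable (fun x : EuclideanSpace ℝ (Fin n) => dist x x₀) := by fun_prop
    exact hdm measurableSet_Ioo
  set g : EuclideanSpace ℝ (Fin n) → ℝ≥0∞ := A.indicator (fun x => Q x * ψ (dist x x₀) ^ n) with hg
  have hgm : Measurable g := by
    refine Measurable.indicator ?_ hAm
    have hdm : Measurable (fun x : EuclideanSpace ℝ (Fin n) => dist x x₀) := by fun_prop
    exact hQ.mul ((hψm.comp hdm).pow_const n)
  rw [← lintegral_indicator hAm, ← lintegral_add_left_eq_self _ x₀,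
    polar_lintegral n hn (fun x => g (x₀ + x)) (hgm.comp (measurable_const_add x₀)),
    ← lintegral_const_mul _ hψm, ← lintegral_indicator measurableSet_Ioi,
    ← lintegral_indicator measurableSet_Ioo]
  rw [ae_restrict_iff' measurableSet_Ioo] at hqfin
  refine lintegral_congr_ae ?_
  filter_upwards [hqfin] with r hr
  by_cases h0 : 0 < r
  swap
  · rw [indicator_of_notMem (by simpa using h0), indicator_of_notMem]
    intro h; exact h0 (hε.trans h.1)
  rw [indicator_of_mem (by simpa using h0)]
  have hd : ∀ θ : Metric.sphere (0 : EuclideanSpace ℝ (Fin n)) 1,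
      dist (x₀ + r • (θ : EuclideanSpace ℝ (Fin n))) x₀ = r := by
    intro θ
    simp [dist_eq_norm, norm_smul, abs_of_pos h0]
  by_cases h1 : r ∈ Set.Ioo ε ε₀
  swap
  · rw [indicator_of_notMem h1]
    have : ∀ θ : Metric.sphere (0 : EuclideanSpace ℝ (Fin n)) 1,
        g (x₀ + r • (θ : EuclideanSpace ℝ (Fin n))) = 0 := by
      intro θ
      apply indicator_of_notMem
      rw [hA, mem_ofPred_eq, hd]
      exact h1
    simp [this]
  rw [indicator_of_mem h1]
  obtain ⟨hq0, hqt⟩ := hr ⟨h0, h1.2⟩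
  have hgθ : ∀ θ : Metric.sphere (0 : EuclideanSpace ℝ (Fin n)) 1,
        g (x₀ + r • (θ : EuclideanSpace ℝ (Fin n))) =
        Q (x₀ + r • (θ : EuclideanSpace ℝ (Fin n))) * ψ r ^ n := by
    intro θ
    rw [hg, indicator_of_mem]
    · rw [hd]
    · rw [hA, mem_ofPred_eq, hd]
      exact h1
  simp_rw [hgθ]
  have hQr : Measurable (fun θ : Metric.sphere (0 : EuclideanSpace ℝ (Fin n)) 1 =>
      Q (x₀ + r • (θ : EuclideanSpace ℝ (Fin n)))) := by
    apply hQ.comp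
    exact (measurable_subtype_coe.const_smul r).const_add x₀
  rw [lintegral_mul_const _ hQr]
  have hint : ∫⁻ θ : Metric.sphere (0 : EuclideanSpace ℝ (Fin n)) 1,
      Q (x₀ + r • (θ : EuclideanSpace ℝ (Fin n))) ∂(sphereMeasure n) = sphereArea n * q r := by
    rw [hq, sphericalMean, ENNReal.mul_div_cancel hω0 hω]
  rw [hint]
  obtain ⟨m, rfl⟩ : ∃ m, n = m + 1 := ⟨n - 1, by omega⟩
  have hm : (m : ℝ) ≠ 0 := by
    have : m ≠ 0 := by omega
    exact_mod_cast this
  set b := q r ^ (1 / (((m + 1 : ℕ) : ℝ) - 1)) with hb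
  have hqb : q r = b ^ m := by
    rw [hb, ← ENNReal.rpow_natCast, ← ENNReal.rpow_mul]
    have : (1 / (((m + 1 : ℕ) : ℝ) - 1)) * (m : ℝ) = 1 := by
      push_cast; field_simp; simp [hm]
    rw [this, ENNReal.rpow_one]
  have hb0 : b ≠ 0 := by
    intro h; rw [h, zero_pow (by omega)] at hqb; exact hq0.ne' hqb
  have hbt : b ≠ ∞ := by
    intro h; rw [h, ENNReal.top_pow (by omega)] at hqb; exact hqt.ne hqb
  have hc0 : ENNReal.ofReal r * b ≠ 0 := mul_ne_zero (by simpa using h0) hb0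
  have hct : ENNReal.ofReal r * b ≠ ∞ := ENNReal.mul_ne_top (by simp) hbt
  have hψr : ψ r = (ENNReal.ofReal r * b)⁻¹ := hψ r
  rw [hψr, hqb, ENNReal.ofReal_pow h0.le, Nat.add_sub_cancel]
  calc ENNReal.ofReal r ^ m * (sphereArea (m+1) * b ^ m * (ENNReal.ofReal r * b)⁻¹ ^ (m + 1))
      = sphereArea (m+1) * (((ENNReal.ofReal r * b) * (ENNReal.ofReal r * b)⁻¹) ^ m
          * (ENNReal.ofReal r * b)⁻¹) := by ring
    _ = _ := by rw [ENNReal.mul_inv_cancel hc0 hct, one_pow, one_mul]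

theorem tendsto_I (ε₀ : ℝ) (ψ : ℝ → ℝ≥0∞)
    (hdiv : ∫⁻ t in Set.Ioo (0:ℝ) ε₀, ψ t = ∞) :
    Tendsto (fun ε : ℝ => ∫⁻ t in Set.Ioo ε ε₀, ψ t) (nhdsWithin 0 (Set.Ioi 0)) (nhds ∞) := by
  have hU : Set.Ioo (0:ℝ) ε₀ = ⋃ k : ℕ, Set.Ioo (1 / ((k:ℝ) + 1)) ε₀ := by
    ext t
    simp only [mem_Ioo, mem_iUnion]
    constructor
    · rintro ⟨h, h'⟩
      obtain ⟨k, hk⟩ := exists_nat_one_div_lt h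
      exact ⟨k, hk, h'⟩
    · rintro ⟨k, h, h'⟩
      exact ⟨lt_trans (by positivity) h, h'⟩
  have hdir : Directed (· ⊆ ·) (fun k : ℕ => Set.Ioo (1 / ((k:ℝ) + 1)) ε₀) := by
    apply Monotone.directed_le
    intro a b hab
    exact Set.Ioo_subset_Ioo_left (Nat.one_div_le_one_div hab)
  rw [hU, setLIntegral_iUnion_of_directed _ hdir] at hdiv
  rw [ENNReal.tendsto_nhds_top_iff_nnreal]
  intro M
  obtain ⟨k, hk⟩ := lt_iSup_iff.1 (hdiv ▸ (ENNReal.coe_lt_top : (M : ℝ≥0∞) < ∞))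
  have : Set.Ioo (0:ℝ) (1 / ((k:ℝ) + 1)) ∈ 𝓝[>] (0:ℝ) := Ioo_mem_nhdsGT (by positivity)
  filter_upwards [this] with ε hε
  exact hk.trans_le (lintegral_mono_set (Set.Ioo_subset_Ioo_left hε.2.le))

/-- With `ψ(t) = 1/(t·q(t)^{1/(n-1)})`, `q` the spherical mean of `Q` at `x₀`,
if `∫_0^{ε₀} ψ = ∞` while `I(ε,ε₀) = ∫_ε^{ε₀} ψ < ∞` for every `ε ∈ (0,ε₀)`, then
`∫_{ε<|x-x₀|<ε₀} Q(x) ψ(|x-x₀|)ⁿ dm(x) = o(I(ε,ε₀)ⁿ)` as `ε → 0⁺`. -/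
theorem stmt3 (n : ℕ) (hn : 2 ≤ n) (x₀ : EuclideanSpace ℝ (Fin n)) (ε₀ : ℝ) (hε₀ : 0 < ε₀)
    (Q : EuclideanSpace ℝ (Fin n) → ℝ≥0∞) (hQ : Measurable Q)
    (q : ℝ → ℝ≥0∞) (hq : ∀ r : ℝ, q r = sphericalMean n Q x₀ r)
    (hqmeas : Measurable q)
    (hqfin : ∀ᵐ r ∂(volume.restrict (Set.Ioo (0:ℝ) ε₀)), 0 < q r ∧ q r < ∞)
    (ψ : ℝ → ℝ≥0∞)
    (hψ : ∀ t : ℝ, ψ t = (ENNReal.ofReal t * q t ^ (1 / ((n : ℝ) - 1)))⁻¹)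
    (hdiv : ∫⁻ t in Set.Ioo (0:ℝ) ε₀, ψ t = ∞)
    (hfin : ∀ ε ∈ Set.Ioo (0:ℝ) ε₀, ∫⁻ t in Set.Ioo ε ε₀, ψ t < ∞) :
    Tendsto (fun ε : ℝ =>
      (∫⁻ x in {x : EuclideanSpace ℝ (Fin n) | ε < dist x x₀ ∧ dist x x₀ < ε₀},
          Q x * ψ (dist x x₀) ^ n) / (∫⁻ t in Set.Ioo ε ε₀, ψ t) ^ n)
      (nhdsWithin 0 (Set.Ioi 0)) (nhds 0) := by
  have hψm : Measurable ψ := by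
    rw [funext hψ]
    exact (ENNReal.measurable_ofReal.mul (hqmeas.pow_const _)).inv
  have hI := tendsto_I ε₀ ψ hdiv
  have hfinm : IsFiniteMeasure (sphereMeasure n) := by unfold sphereMeasure; infer_instance
  have hω : sphereArea n ≠ ∞ := measure_ne_top _ _
  have hlim : Tendsto (fun ε : ℝ => sphereArea n * (∫⁻ t in Set.Ioo ε ε₀, ψ t)⁻¹)
      (nhdsWithin 0 (Set.Ioi 0)) (nhds 0) := by
    have h1 := ENNReal.Tendsto.const_mul (a := sphereArea n)
      (ENNReal.tendsto_inv_iff.2 hI) (Or.inr hω)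
    simpa using h1
  refine tendsto_of_tendsto_of_tendsto_of_le_of_le' tendsto_const_nhds hlim
    (Eventually.of_forall fun _ => zero_le) ?_
  have hev : Set.Ioo (0:ℝ) ε₀ ∈ nhdsWithin (0:ℝ) (Set.Ioi 0) := Ioo_mem_nhdsGT hε₀
  filter_upwards [hev, hI.eventually (lt_mem_nhds ENNReal.one_lt_top)] with ε hε h1
  rw [stmt3_aux n hn x₀ ε₀ Q hQ q hq hqfin ψ hψm hψ ε hε.1]
  have ht := hfin ε hε
  set J := ∫⁻ t in Set.Ioo ε ε₀, ψ t
  have hJ0 : J ≠ 0 := (zero_lt_one.trans h1).ne'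
  rw [mul_div_assoc]
  gcongr
  rw [ENNReal.div_le_iff (pow_ne_zero _ hJ0) (ENNReal.pow_ne_top ht.ne)]
  obtain ⟨m, rfl⟩ : ∃ m, n = m + 2 := ⟨n - 2, by omega⟩
  calc J = J⁻¹ * J * J := by rw [ENNReal.inv_mul_cancel hJ0 ht.ne, one_mul]
    _ = J⁻¹ * J ^ 2 := by ring
    _ ≤ J⁻¹ * J ^ (m + 2) := by
      gcongr
      · exact h1.le
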